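/- arXiv:1503.09088 — 3 statements merged into one kernel-verified Lean document; each statement's English description precedes it below -/
import Mathlib

section
/- Let X be a separable real Banach space. If X contains a subspace linearly isometric to c, then there exist x ∈ X, a functional e* in the dual X*, and a sequence (eₙ*) of extreme points of the closed unit ball of X* such that (eₙ*) converges to e* in the weak-* topology, eₙ*(x) = e*(x) = ‖e*‖ = ‖x‖ = 1 for every n ∈ ℕ, and ‖eₙ* + e*‖ = ‖eₙ* − e*‖ = 2 for every n ∈ ℕ. -/
open Filter Topology ENNReal

noncomputable section

/-- `ℓ∞`, the space of bounded real sequences. -/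
abbrev ellInfty : Type := ↥(lp (fun _ : ℕ => ℝ) ∞)

/-- The space `c` of convergent real sequences, as a submodule of `ℓ∞`. -/
def cSub : Submodule ℝ ellInfty where
  carrier := {x | ∃ l : ℝ, Tendsto (fun i => (x : ℕ → ℝ) i) atTop (𝓝 l)}
  add_mem' := by
    rintro x y ⟨l, hl⟩ ⟨m, hm⟩
    refine ⟨l + m, (hl.add hm).congr fun i => ?_⟩
    simp [lp.coeFn_add]
  zero_mem' := ⟨0, by simp [lp.coeFn_zero, tendsto_const_nhds]⟩
  smul_mem' := by
    rintro a x ⟨l, hl⟩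
    refine ⟨a * l, ((hl.const_mul a)).congr fun i => ?_⟩
    simp [lp.coeFn_smul]

/-- The Banach space `c` of convergent real sequences with the sup norm. -/
abbrev cSpace : Type := ↥cSub

/-- Every vector of a real normed space is normed by an extreme point of the dual unit ball. -/
theorem exists_extremePoint_closedBall_apply_eq_norm {X : Type*} [NormedAddCommGroup X]
    [NormedSpace ℝ X] (v : X) :
    ∃ f ∈ (Metric.closedBall (0 : X →L[ℝ] ℝ) 1).extremePoints ℝ, f v = ‖v‖ := by
  have : LocallyConvexSpace ℝ (WeakDual ℝ X) :=
    (WeakDual.withSeminorms ℝ X).toLocallyConvexSpace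
  set B : Set (WeakDual ℝ X) := WeakDual.toStrongDual ⁻¹' Metric.closedBall 0 1 with hB
  have hBc : IsCompact B := WeakDual.isCompact_closedBall 0 1
  let l : WeakDual ℝ X →L[ℝ] ℝ :=
    { toFun := fun f => f v
      map_add' := fun _ _ => rfl
      map_smul' := fun _ _ => rfl
      cont := WeakDual.eval_continuous v }
  have hle : ∀ f ∈ B, f v ≤ ‖v‖ := fun f hf => by
    have hf' : ‖WeakDual.toStrongDual f‖ ≤ 1 := by simpa [hB] using hf
    exact (le_abs_self _).trans
      (((WeakDual.toStrongDual f).le_of_opNorm_le hf' v).trans_eq (one_mul _))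
  have hexp : IsExposed ℝ B (l.toExposed B) := ContinuousLinearMap.toExposed.isExposed
  obtain ⟨g, hg1, hgv⟩ := exists_dual_vector'' ℝ v
  have hgB : StrongDual.toWeakDual g ∈ B := by simpa [hB] using hg1
  have hgv' : (StrongDual.toWeakDual g) v = ‖v‖ := hgv
  obtain ⟨f, hf⟩ := (hexp.isCompact hBc).extremePoints_nonempty
    ⟨StrongDual.toWeakDual g, hgB, fun y hy => (hle y hy).trans_eq hgv'.symm⟩
  refine ⟨WeakDual.toStrongDual f, ?_, ?_⟩
  · have hfB := Set.mem_image_of_mem WeakDual.toStrongDual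
      (hexp.isExtreme.extremePoints_subset_extremePoints hf)
    rwa [image_extremePoints, hB,
      Set.image_preimage_eq _ WeakDual.toStrongDual.surjective] at hfB
  · exact le_antisymm (hle f hf.1.1) (hgv'.symm.le.trans (hf.1.2 _ hgB))

/-- Geometric core of the main theorem: `u` plays the role of the constant sequence `1` and `s n`
that of the `n`-th unit vector of `c`. -/
theorem exists_weakStar_convergent_extremePoints {X : Type*} [NormedAddCommGroup X]
    [NormedSpace ℝ X] [TopologicalSpace.SeparableSpace X] (u : X) (s : ℕ → X)
    (hu : ‖u‖ ≤ 1) (hs : ∀ n, ‖s n‖ ≤ 1) (hus : ∀ n, ‖u + s n‖ = 2)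
    (hadd : ∀ m n, m ≠ n → ‖s m + s n‖ ≤ 1) (hsub : ∀ m n, m ≠ n → ‖s m - s n‖ ≤ 1)
    (hflip : ∀ n, ‖u - (2 : ℝ) • s n‖ ≤ 1) :
    ∃ (x : X) (estar : X →L[ℝ] ℝ) (e : ℕ → (X →L[ℝ] ℝ)),
      (∀ n, e n ∈ (Metric.closedBall (0 : X →L[ℝ] ℝ) 1).extremePoints ℝ) ∧
      (∀ y : X, Tendsto (fun n => e n y) atTop (𝓝 (estar y))) ∧
      (∀ n, e n x = 1) ∧ estar x = 1 ∧ ‖estar‖ = 1 ∧ ‖x‖ = 1 ∧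
      (∀ n, ‖e n + estar‖ = 2 ∧ ‖e n - estar‖ = 2) := by
  choose f hf hfv using fun n => exists_extremePoint_closedBall_apply_eq_norm (u + s n)
  have hf1 : ∀ n, ‖f n‖ ≤ 1 := fun n => by simpa using (hf n).1
  have bound : ∀ (g : X →L[ℝ] ℝ) (C : ℝ) (y : X), ‖g‖ ≤ C → ‖y‖ ≤ 1 → g y ≤ C :=
    fun g C y hg hy => (le_abs_self _).trans ((g.le_of_opNorm_le hg y).trans
      (mul_le_of_le_one_right ((norm_nonneg g).trans hg) hy))
  have hfsum : ∀ n, f n u + f n (s n) = 2 := fun n => by rw [← map_add, hfv, hus]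
  have hfu : ∀ n, f n u = 1 := fun n => by
    linarith [hfsum n, bound _ _ _ (hf1 n) hu, bound _ _ _ (hf1 n) (hs n)]
  have hfs : ∀ n, f n (s n) = 1 := fun n => by linarith [hfsum n, hfu n]
  have hfs0 : ∀ m n, m ≠ n → f m (s n) = 0 := fun m n hmn => by
    have h1 := bound _ _ _ (hf1 m) (hadd m n hmn)
    have h2 := bound _ _ _ (hf1 m) (hsub m n hmn)
    rw [map_add, hfs] at h1
    rw [map_sub, hfs] at h2
    linarith
  obtain ⟨g, hgB, φ, hφ, hlim⟩ := WeakDual.isSeqCompact_closedBall ℝ X 0 1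
    (x := fun n => StrongDual.toWeakDual (f n)) (fun n => by simpa using hf1 n)
  have hlim' : ∀ y : X, Tendsto (fun n => f (φ n) y) atTop (𝓝 (WeakDual.toStrongDual g y)) :=
    fun y => ((WeakDual.eval_continuous y).tendsto g).comp hlim
  set estar : X →L[ℝ] ℝ := WeakDual.toStrongDual g
  have hg1 : ‖estar‖ ≤ 1 := by simpa using hgB
  have hgu : estar u = 1 := by
    refine tendsto_nhds_unique (hlim' u) ?_
    simp only [hfu]
    exact tendsto_const_nhds
  have hgs : ∀ n, estar (s n) = 0 := fun n => by
    refine tendsto_nhds_unique (hlim' (s n)) (tendsto_const_nhds.congr' ?_)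
    filter_upwards [eventually_gt_atTop n] with k hk
    exact (hfs0 _ _ (hk.trans_le hφ.le_apply).ne').symm
  have hnu : ‖u‖ = 1 := le_antisymm hu <| by
    have := estar.le_of_opNorm_le hg1 u
    rwa [hgu, norm_one, one_mul] at this
  refine ⟨u, estar, fun n => f (φ n), fun n => hf _, hlim', fun n => hfu _, hgu,
    le_antisymm hg1 ?_, hnu, fun n => ⟨le_antisymm ?_ ?_, le_antisymm ?_ ?_⟩⟩
  · exact hgu.symm.le.trans (bound _ _ _ le_rfl hu)
  · linarith [norm_add_le (f (φ n)) estar, hf1 (φ n)]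
  · have := bound (f (φ n) + estar) _ u le_rfl hu
    rw [add_apply, hfu, hgu] at this
    linarith
  · linarith [norm_sub_le (f (φ n)) estar, hf1 (φ n)]
  · have := bound (f (φ n) - estar) _ (-(u - (2 : ℝ) • s (φ n))) le_rfl
      ((norm_neg _).trans_le (hflip _))
    simp only [sub_apply, map_neg, map_sub, map_smul, hfu, hgu, hfs, hgs,
      smul_eq_mul] at this
    linarith

/-- The constant sequence `1` in `c`. -/
def cOne : cSpace := ⟨1, 1, by simp [lp.infty_coeFn_one]⟩

/-- The `n`-th unit vector in `c`. -/
def cUnit (n : ℕ) : cSpace := ⟨lp.single ∞ n 1, 0, by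
  refine tendsto_const_nhds.congr' ?_
  filter_upwards [eventually_gt_atTop n] with k hk
  simp [hk.ne']⟩

theorem cOne_apply (i : ℕ) : ((cOne : ellInfty) : ℕ → ℝ) i = 1 := by
  simp [cOne, lp.infty_coeFn_one]

theorem cUnit_apply (n i : ℕ) :
    ((cUnit n : ellInfty) : ℕ → ℝ) i = if i = n then 1 else 0 := by
  simp [cUnit, Pi.single_apply]

theorem cSpace_norm_le {x : cSpace} {C : ℝ} (hx : ∀ i, |((x : ellInfty) : ℕ → ℝ) i| ≤ C) :
    ‖x‖ ≤ C :=
  lp.norm_le_of_forall_le' C hx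

/-- If a separable real Banach space `X` contains a subspace linearly
isometric to `c`, then there are `x ∈ X`, a functional `e* ∈ X*` and a sequence `(eₙ*)` of
extreme points of the closed unit ball of `X*`, weak-* convergent to `e*`, with
`eₙ*(x) = e*(x) = ‖e*‖ = ‖x‖ = 1` and `‖eₙ* + e*‖ = ‖eₙ* − e*‖ = 2` for all `n`. -/
theorem statement0 (X : Type*) [NormedAddCommGroup X] [NormedSpace ℝ X] [CompleteSpace X]
    [TopologicalSpace.SeparableSpace X]
    (h : Nonempty (cSpace →ₗᵢ[ℝ] X)) :
    ∃ (x : X) (estar : X →L[ℝ] ℝ) (e : ℕ → (X →L[ℝ] ℝ)),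
      (∀ n, e n ∈ (Metric.closedBall (0 : X →L[ℝ] ℝ) 1).extremePoints ℝ) ∧
      (∀ y : X, Tendsto (fun n => e n y) atTop (𝓝 (estar y))) ∧
      (∀ n, e n x = 1) ∧ estar x = 1 ∧ ‖estar‖ = 1 ∧ ‖x‖ = 1 ∧
      (∀ n, ‖e n + estar‖ = 2 ∧ ‖e n - estar‖ = 2) := by
  obtain ⟨T⟩ := h
  refine exists_weakStar_convergent_extremePoints (T cOne) (fun n => T (cUnit n))
    ?_ (fun n => ?_) (fun n => ?_) (fun m n hmn => ?_) (fun m n hmn => ?_) (fun n => ?_)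
  all_goals simp only [← map_add, ← map_sub, ← map_smul, T.norm_map]
  · exact cSpace_norm_le fun i => by simp [cOne_apply]
  · refine cSpace_norm_le fun i => ?_
    rw [cUnit_apply]
    split_ifs <;> simp
  · refine le_antisymm (cSpace_norm_le fun i => ?_) ?_
    · simp only [Submodule.coe_add, lp.coeFn_add, Pi.add_apply, cOne_apply, cUnit_apply]
      split_ifs <;> norm_num
    · have := lp.norm_apply_le_norm ENNReal.top_ne_zero ((cOne + cUnit n : cSpace) : ellInfty) n
      simp only [Submodule.coe_add, lp.coeFn_add, Pi.add_apply, cOne_apply, cUnit_apply] at this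
      norm_num at this
      exact this
  · refine cSpace_norm_le fun i => ?_
    simp only [Submodule.coe_add, lp.coeFn_add, Pi.add_apply, cUnit_apply]
    split_ifs <;> first | omega | norm_num
  · refine cSpace_norm_le fun i => ?_
    simp only [Submodule.coe_sub, lp.coeFn_sub, Pi.sub_apply, cUnit_apply]
    split_ifs <;> norm_num
  · refine cSpace_norm_le fun i => ?_
    simp only [Submodule.coe_sub, lp.coeFn_sub, Pi.sub_apply, Submodule.coe_smul,
      lp.coeFn_smul, Pi.smul_apply, cOne_apply, cUnit_apply, smul_eq_mul]
    split_ifs <;> norm_num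
end
end

section
/- Let X be a real Banach space and let T : c → X be a linear isometric embedding. Let x = (1,1,1,…) ∈ c, and for each n ∈ ℕ let xₙ ∈ c be the sequence whose n-th coordinate is −1 and all whose other coordinates are 1. Then for every n ∈ ℕ the set Fₙ = {x* ∈ B_{X*} : x*(Txₙ) = −1, x*(Tx_m) = 1 for all m ≠ n, and x*(Tx) = 1} is nonempty. -/
open Filter Topology ENNReal

noncomputable section

/-- The constant sequence `(1,1,1,…)` as an element of `c`. -/
def onesC : cSpace :=
  ⟨⟨(fun _ => 1 : ∀ _ : ℕ, ℝ), memℓp_infty ⟨1, by rintro r ⟨i, rfl⟩; simp⟩⟩,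
    ⟨1, tendsto_const_nhds⟩⟩

/-- The sequence whose `n`-th coordinate is `-1` and all other coordinates are `1`,
as an element of `c`. -/
def flipC (n : ℕ) : cSpace :=
  ⟨⟨(fun i => if i = n then -1 else 1 : ∀ _ : ℕ, ℝ),
      memℓp_infty ⟨1, by rintro r ⟨i, rfl⟩; by_cases h : i = n <;> simp [h]⟩⟩,
    ⟨1, tendsto_const_nhds.congr' (by
      filter_upwards [eventually_gt_atTop n] with i hi
      simp [Nat.ne_of_gt hi])⟩⟩


/-- The face `Fₙ` of the dual unit ball determined by the isometric copy of `c`. -/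
def faceF (X : Type*) [NormedAddCommGroup X] [NormedSpace ℝ X]
    (T : cSpace →ₗᵢ[ℝ] X) (n : ℕ) : Set (X →L[ℝ] ℝ) :=
  {f | ‖f‖ ≤ 1 ∧ f (T (flipC n)) = -1 ∧ (∀ m, m ≠ n → f (T (flipC m)) = 1) ∧ f (T onesC) = 1}

/-- The `n`-th coordinate functional on `c`. -/
def coordC (n : ℕ) : cSpace →L[ℝ] ℝ :=
  LinearMap.mkContinuous
    { toFun := fun x => (x : ellInfty) n
      map_add' := fun _ _ => rfl
      map_smul' := fun _ _ => rfl } 1 fun x =>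
    (lp.norm_apply_le_norm ENNReal.top_ne_zero (x : ellInfty) n).trans_eq (one_mul ‖x‖).symm

theorem coordC_apply (n : ℕ) (x : cSpace) : coordC n x = (x : ellInfty) n := rfl

theorem norm_coordC_le (n : ℕ) : ‖coordC n‖ ≤ 1 :=
  LinearMap.mkContinuous_norm_le _ zero_le_one _

theorem coordC_onesC (n : ℕ) : coordC n onesC = 1 := rfl

theorem coordC_flipC (n m : ℕ) : coordC n (flipC m) = if n = m then -1 else 1 := rfl

/-- A functional extends along a linear isometric embedding without increasing its norm. -/
theorem LinearIsometry.exists_dual_extension {E X : Type*} [NormedAddCommGroup E]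
    [NormedSpace ℝ E] [NormedAddCommGroup X] [NormedSpace ℝ X] (T : E →ₗᵢ[ℝ] X)
    (g : E →L[ℝ] ℝ) : ∃ f : X →L[ℝ] ℝ, ‖f‖ ≤ ‖g‖ ∧ ∀ x, f (T x) = g x := by
  let e := T.equivRange
  let g' := g.comp (e.symm.toContinuousLinearEquiv : T.range →L[ℝ] E)
  obtain ⟨f, hf, hnorm⟩ := exists_extension_norm_eq _ g'
  refine ⟨f, hnorm.le.trans ?_, fun x => ?_⟩
  · refine ContinuousLinearMap.opNorm_le_bound _ (norm_nonneg g) fun y => ?_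
    simpa [g'] using g.le_opNorm (e.symm y)
  · have h := hf (e x)
    have hg : g' (e x) = g x := by simp [g']
    exact h.trans hg

/-- Each set `Fₙ` is nonempty. -/
theorem statement1 (X : Type*) [NormedAddCommGroup X] [NormedSpace ℝ X]
    (T : cSpace →ₗᵢ[ℝ] X) (n : ℕ) : (faceF X T n).Nonempty := by
  obtain ⟨f, hf, hfT⟩ := T.exists_dual_extension (coordC n)
  refine ⟨f, hf.trans (norm_coordC_le n), ?_, fun m hm => ?_, ?_⟩
  · simp [hfT, coordC_flipC]
  · simp [hfT, coordC_flipC, hm.symm]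
  · rw [hfT, coordC_onesC]
end
end

section
/- Let X be a real Banach space and let φ : ℓ₁ → X* be a surjective linear isometry. If X contains a subspace linearly isometric to c, then there exist x ∈ B_X, an element e* ∈ ℓ₁, and a strictly increasing sequence (n_k) of natural numbers such that: (1) φ(e_{n_k}) converges to φ(e*) in the weak-* topology of X* and e*(n_k) = 0 for every k ∈ ℕ (so that the supports of e_{n_k} and e* are disjoint), and (2) (φ(e_{n_k}))(x) = (φ(e*))(x) = 1 for every k ∈ ℕ. -/
open Filter Topology ENNReal

noncomputable section

abbrev ellOne : Type := ↥(lp (fun _ : ℕ => ℝ) 1)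

theorem TopologicalSpace.SeparableSpace.of_strongDual (X : Type*) [NormedAddCommGroup X]
    [NormedSpace ℝ X] [TopologicalSpace.SeparableSpace (X →L[ℝ] ℝ)] :
    TopologicalSpace.SeparableSpace X := by
  obtain ⟨ψ, hψ⟩ := TopologicalSpace.exists_dense_seq (X →L[ℝ] ℝ)
  have almost_norming (f : X →L[ℝ] ℝ) : ∃ x : X, ‖x‖ ≤ 1 ∧ ‖f‖ / 2 ≤ ‖f x‖ := by
    rcases eq_or_ne f 0 with rfl | hf
    · exact ⟨0, by simp, by simp⟩
    · obtain ⟨x, hx, hfx⟩ := f.exists_lt_apply_of_lt_opNorm (half_lt_self (norm_pos_iff.2 hf))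
      exact ⟨x, hx.le, hfx.le⟩
  choose x hx hxψ using fun n => almost_norming (ψ n)
  set S := (Submodule.span ℝ (Set.range x)).topologicalClosure with hS
  have hsep : TopologicalSpace.IsSeparable (S : Set X) := by
    rw [hS, Submodule.topologicalClosure_coe]
    exact ((Set.countable_range x).isSeparable.span (R := ℝ)).closure
  have hxS (n : ℕ) : x n ∈ S :=
    Submodule.le_topologicalClosure _ (Submodule.subset_span ⟨n, rfl⟩)
  suffices hS_univ : (S : Set X) = Set.univ from
    TopologicalSpace.isSeparable_univ_iff.1 (hS_univ ▸ hsep)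
  by_contra hne
  obtain ⟨v, hv⟩ := (Set.ne_univ_iff_exists_notMem _).1 hne
  obtain ⟨f, u, hfS, hfv⟩ := geometric_hahn_banach_closed_point S.convex
    (Submodule.isClosed_topologicalClosure _) hv
  have hu : 0 < u := by simpa using hfS 0 S.zero_mem
  have hf_zero (a : X) (ha : a ∈ S) : f a = 0 := by
    by_contra hfa
    have := hfS ((u / f a) • a) (S.smul_mem _ ha)
    simp [div_mul_cancel₀ _ hfa] at this
  have hf : 0 < ‖f‖ := norm_pos_iff.2 fun h0 => by simp [h0] at hfv; linarith
  obtain ⟨n, hn⟩ := hψ.exists_dist_lt f (by positivity : 0 < ‖f‖ / 4)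
  rw [dist_eq_norm] at hn
  have hle := (f - ψ n).le_of_opNorm_le_of_le le_rfl (hx n)
  have hnorm := norm_sub_norm_le f (ψ n)
  have hval : ‖(f - ψ n) (x n)‖ = ‖ψ n (x n)‖ := by
    rw [sub_apply, hf_zero _ (hxS n), zero_sub, norm_neg]
  linarith [hxψ n]

instance : TopologicalSpace.SeparableSpace ellOne := by
  rw [← TopologicalSpace.isSeparable_univ_iff]
  refine ((Set.countable_range fun i : ℕ =>
    (lp.single 1 i (1 : ℝ) : ellOne)).isSeparable.span (R := ℝ)).closure.mono fun y _ => ?_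
  refine mem_closure_of_tendsto (lp.hasSum_single one_ne_top y)
    (Eventually.of_forall fun s => Submodule.sum_mem _ fun i _ => ?_)
  have : (lp.single 1 i (y i) : ellOne) = y i • lp.single 1 i (1 : ℝ) := by
    rw [← lp.single_smul]; simp
  rw [this]
  exact Submodule.smul_mem _ _ (Submodule.subset_span ⟨i, rfl⟩)

theorem ellOne.hasSum_abs (y : ellOne) : HasSum (fun i => |y i|) ‖y‖ := by
  simpa using lp.hasSum_norm (by simp) y

theorem ellOne.hasSum_apply {F : Type*} [NormedAddCommGroup F] [NormedSpace ℝ F]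
    (L : ellOne →L[ℝ] F) (y : ellOne) :
    HasSum (fun i => y i • L (lp.single 1 i (1 : ℝ))) (L y) := by
  refine ((lp.hasSum_single one_ne_top y).mapL L).congr_fun fun i => ?_
  rw [← map_smul, ← lp.single_smul]; simp

theorem mul_eq_abs_of_hasSum {ι : Type*} {y a : ι → ℝ} {r s : ℝ} (hy : HasSum (fun i => |y i|) r)
    (ha : ∀ i, |a i| ≤ 1) (hs : HasSum (fun i => y i * a i) s) (hrs : r ≤ s) (i : ι) :
    y i * a i = |y i| := by
  have hnonneg (j : ι) : 0 ≤ |y j| - y j * a j := by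
    have h1 := le_abs_self (y j * a j)
    rw [abs_mul] at h1
    have h2 := mul_le_mul_of_nonneg_left (ha j) (abs_nonneg (y j))
    linarith
  have hsub := hy.sub hs
  have hzero : r - s = 0 := le_antisymm (sub_nonpos.2 hrs) (hsub.nonneg hnonneg)
  rw [hzero, hasSum_zero_iff_of_nonneg hnonneg] at hsub
  have := congrFun hsub i
  simp only [Pi.zero_apply] at this
  linarith

theorem ContinuousLinearMap.abs_apply_le_one {X : Type*} [NormedAddCommGroup X] [NormedSpace ℝ X]
    {g : X →L[ℝ] ℝ} {v : X} (hg : ‖g‖ ≤ 1) (hv : ‖v‖ ≤ 1) : |g v| ≤ 1 := by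
  simpa using g.le_of_opNorm_le_of_le hg hv

section Dual

variable {X : Type*} [NormedAddCommGroup X] [NormedSpace ℝ X] (φ : ellOne →ₗᵢ[ℝ] (X →L[ℝ] ℝ))

theorem norm_map_single (i : ℕ) : ‖φ (lp.single 1 i (1 : ℝ))‖ = 1 := by
  rw [φ.norm_map, lp.norm_single one_pos, norm_one]

theorem hasSum_map_apply (y : ellOne) (v : X) :
    HasSum (fun i => y i * φ (lp.single 1 i (1 : ℝ)) v) (φ y v) := by
  simpa using ellOne.hasSum_apply
    ((ContinuousLinearMap.apply ℝ ℝ v).comp φ.toContinuousLinearMap) y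

/-- A functional `φ y` in the unit ball attaining the value `1` at a point `v` of the unit ball
does so coordinatewise. -/
theorem mul_map_single_eq_abs {y : ellOne} (hy : ‖y‖ ≤ 1) {v : X} (hv : ‖v‖ ≤ 1)
    (hyv : φ y v = 1) (i : ℕ) : y i * φ (lp.single 1 i (1 : ℝ)) v = |y i| :=
  mul_eq_abs_of_hasSum y.hasSum_abs
    (fun j => ContinuousLinearMap.abs_apply_le_one (norm_map_single φ j).le hv)
    (hasSum_map_apply φ y v) (hyv.symm ▸ hy) i

theorem exists_weakStar_tendsto_subseq [TopologicalSpace.SeparableSpace X]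
    (hφ : Function.Surjective φ) {y : ℕ → ellOne} (hy : ∀ n, ‖y n‖ ≤ 1) :
    ∃ z : ellOne, ‖z‖ ≤ 1 ∧ ∃ ψ : ℕ → ℕ, StrictMono ψ ∧
      ∀ v : X, Tendsto (fun k => φ (y (ψ k)) v) atTop (𝓝 (φ z v)) := by
  obtain ⟨g, hg, ψ, hψ, hlim⟩ := WeakDual.isSeqCompact_closedBall ℝ X 0 1
    (x := fun n => StrongDual.toWeakDual (φ (y n))) fun n => by
      simpa using hy n
  obtain ⟨z, hz⟩ := hφ (WeakDual.toStrongDual g)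
  refine ⟨z, ?_, ψ, hψ, fun v => ?_⟩
  · rw [← φ.norm_map, hz]
    simpa using hg
  · rw [hz]
    exact ((WeakDual.eval_continuous v).tendsto g).comp hlim

end Dual

theorem norm_onesC_le : ‖onesC‖ ≤ 1 :=
  lp.norm_le_of_forall_le zero_le_one fun i => by simp [onesC]

theorem norm_flipC_le (n : ℕ) : ‖flipC n‖ ≤ 1 :=
  lp.norm_le_of_forall_le zero_le_one fun i => by
    by_cases h : i = n <;> simp [flipC, h]

theorem two_le_norm_onesC_sub_flipC (n : ℕ) : 2 ≤ ‖onesC - flipC n‖ := by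
  have : ‖(1 : ℝ) - if n = n then -1 else 1‖ ≤ ‖onesC - flipC n‖ :=
    lp.norm_apply_le_norm top_ne_zero (onesC - flipC n : cSpace).1 n
  norm_num at this
  exact this

theorem norm_onesC_add_sub_flipC_sub_flipC_le {n k : ℕ} (h : k ≠ n) :
    ‖(onesC - flipC n) + (onesC - flipC k)‖ ≤ 2 :=
  lp.norm_le_of_forall_le zero_le_two fun i => by
    change ‖((1 : ℝ) - if i = n then -1 else 1) + (1 - if i = k then -1 else 1)‖ ≤ 2
    rcases eq_or_ne i n with rfl | hn
    · norm_num [h.symm]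
    · rw [if_neg hn]
      split_ifs <;> norm_num

/-- A norm-one functional extending the `n`-th coordinate functional of `c`, tested on the vectors
`onesC` and `flipC k`. -/
theorem exists_dual_coordinate {X : Type*} [NormedAddCommGroup X] [NormedSpace ℝ X]
    (T : cSpace →ₗᵢ[ℝ] X) (n : ℕ) :
    ∃ g : X →L[ℝ] ℝ, ‖g‖ ≤ 1 ∧ g (T onesC) = 1 ∧
      ∀ k, g (T (flipC k)) = if k = n then -1 else 1 := by
  obtain ⟨g, hg, hgv⟩ := exists_dual_vector'' ℝ (T (onesC - flipC n))
  have hone := abs_le.1 (ContinuousLinearMap.abs_apply_le_one hg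
    ((T.norm_map onesC).trans_le norm_onesC_le))
  have hflip (k : ℕ) := abs_le.1 (ContinuousLinearMap.abs_apply_le_one hg
    ((T.norm_map (flipC k)).trans_le (norm_flipC_le k)))
  have hnorm := two_le_norm_onesC_sub_flipC n
  rw [T.norm_map, map_sub, map_sub, RCLike.ofReal_real_eq_id, id] at hgv
  refine ⟨g, hg, by linarith [hflip n], fun k => ?_⟩
  split_ifs with h
  · subst h
    linarith [hflip k]
  · have hle := g.le_of_opNorm_le_of_le hg
      ((T.norm_map _).trans_le (norm_onesC_add_sub_flipC_sub_flipC_le h))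
    simp only [map_add, map_sub, one_mul] at hle
    have := (le_abs_self _).trans hle
    linarith [hflip n, hflip k]

/-- Up to sign, some basis vector extends the `n`-th coordinate functional of `c`. -/
theorem exists_single_coordinate {X : Type*} [NormedAddCommGroup X] [NormedSpace ℝ X]
    {φ : ellOne →ₗᵢ[ℝ] (X →L[ℝ] ℝ)} (hφ : Function.Surjective φ) (T : cSpace →ₗᵢ[ℝ] X) (n : ℕ) :
    ∃ (m : ℕ) (s : ℝ), (s = 1 ∨ s = -1) ∧ φ (lp.single 1 m (1 : ℝ)) (T onesC) = s ∧
      ∀ k, φ (lp.single 1 m (1 : ℝ)) (T (flipC k)) = if k = n then -s else s := by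
  obtain ⟨g, hg, hone, hflip⟩ := exists_dual_coordinate T n
  obtain ⟨y, rfl⟩ := hφ g
  rw [φ.norm_map] at hg
  obtain ⟨m, hm⟩ : ∃ m, y m ≠ 0 := by
    by_contra! h
    have : y = 0 := lp.ext (funext h)
    simp [this] at hone
  have key {v : X} (hv : ‖v‖ ≤ 1) (h : φ y v = 1) :
      φ (lp.single 1 m (1 : ℝ)) v = |y m| / y m := by
    rw [eq_div_iff hm, mul_comm]
    exact mul_map_single_eq_abs φ hg hv h m
  refine ⟨m, |y m| / y m, ?_, key ((T.norm_map _).trans_le norm_onesC_le) hone, fun k => ?_⟩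
  · rcases abs_choice (y m) with h | h <;> simp [h, hm]
  · have hk := (T.norm_map _).trans_le (norm_flipC_le k)
    split_ifs with h
    · have := key (v := -T (flipC k)) (by rwa [norm_neg]) (by simp [hflip, h])
      rw [map_neg] at this
      linarith
    · exact key hk (by simp [hflip, h])

theorem exists_of_coordinate_sequence {X : Type*} [NormedAddCommGroup X] [NormedSpace ℝ X]
    {φ : ellOne →ₗᵢ[ℝ] (X →L[ℝ] ℝ)} (hφ : Function.Surjective φ) {x : X} {f : ℕ → X} {m : ℕ → ℕ}
    (hx : ‖x‖ ≤ 1) (hf : ∀ k, ‖f k‖ ≤ 1) (hm : StrictMono m)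
    (hmx : ∀ n, φ (lp.single 1 (m n) (1 : ℝ)) x = 1)
    (hmf : ∀ n k, φ (lp.single 1 (m n) (1 : ℝ)) (f k) = if k = n then -1 else 1) :
    ∃ (x : X) (estar : ellOne) (nk : ℕ → ℕ), ‖x‖ ≤ 1 ∧ StrictMono nk ∧
      (∀ v : X, Tendsto (fun k => φ (lp.single 1 (nk k) (1 : ℝ)) v) atTop (𝓝 (φ estar v))) ∧
      (∀ k, (estar : ℕ → ℝ) (nk k) = 0) ∧
      (∀ k, φ (lp.single 1 (nk k) (1 : ℝ)) x = 1) ∧ φ estar x = 1 := by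
  have : TopologicalSpace.SeparableSpace (X →L[ℝ] ℝ) :=
    hφ.denseRange.separableSpace φ.continuous
  have := TopologicalSpace.SeparableSpace.of_strongDual X
  obtain ⟨z, hz, ψ, hψ, hlim⟩ := exists_weakStar_tendsto_subseq φ hφ
    (y := fun n => lp.single 1 (m n) (1 : ℝ)) fun n => by
      rw [← φ.norm_map, norm_map_single]
  have hzx : φ z x = 1 := tendsto_nhds_unique (hlim x) (by simp [hmx])
  have hzf (k : ℕ) : φ z (f k) = 1 := by
    refine tendsto_nhds_unique (hlim (f k)) (tendsto_const_nhds.congr' ?_)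
    filter_upwards [hψ.tendsto_atTop.eventually_gt_atTop k] with j hj
    rw [hmf, if_neg hj.ne]
  refine ⟨x, z, m ∘ ψ, hx, hm.comp hψ, hlim, fun k => ?_, fun k => hmx _, hzx⟩
  have h1 := mul_map_single_eq_abs φ hz hx hzx (m (ψ k))
  have h2 := mul_map_single_eq_abs φ hz (hf (ψ k)) (hzf (ψ k)) (m (ψ k))
  rw [hmx] at h1
  rw [hmf, if_pos rfl] at h2
  simp only [Function.comp_apply]
  linarith

/-- Let `X` be a predual of `ℓ₁` via a surjective linear isometry
`φ : ℓ₁ → X*`. If `X` contains a subspace linearly isometric to `c`, then there are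
`x ∈ B_X`, `e* ∈ ℓ₁` and a strictly increasing sequence `(n_k)` such that
`φ(e_{n_k}) → φ(e*)` weak-*, the supports of the `e_{n_k}` and of `e*` are disjoint,
and `φ(e_{n_k})(x) = φ(e*)(x) = 1` for all `k`. -/
theorem statement4 (X : Type*) [NormedAddCommGroup X] [NormedSpace ℝ X]
    (φ : ellOne →ₗᵢ[ℝ] (X →L[ℝ] ℝ)) (hφ : Function.Surjective φ)
    (h : Nonempty (cSpace →ₗᵢ[ℝ] X)) :
    ∃ (x : X) (estar : ellOne) (nk : ℕ → ℕ), ‖x‖ ≤ 1 ∧ StrictMono nk ∧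
      (∀ v : X, Tendsto (fun k => φ (lp.single 1 (nk k) (1 : ℝ)) v) atTop (𝓝 (φ estar v))) ∧
      (∀ k, (estar : ℕ → ℝ) (nk k) = 0) ∧
      (∀ k, φ (lp.single 1 (nk k) (1 : ℝ)) x = 1) ∧ φ estar x = 1 := by
  obtain ⟨T⟩ := h
  choose m s hs hone hflip using exists_single_coordinate hφ T
  have hm : Function.Injective m := fun a b hab => by
    by_contra hne
    have h1 := hflip a a
    have h2 := hflip b a
    have h3 := hone a
    rw [hab] at h1 h3
    rw [if_pos rfl] at h1
    rw [if_neg hne] at h2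
    have := hone b
    rcases hs a with h | h <;> linarith
  obtain ⟨ψ, hψ, hmψ⟩ := strictMono_subseq_of_tendsto_atTop hm.nat_tendsto_atTop
  obtain ⟨σ, hσ, χ, hχ, hsχ⟩ : ∃ σ : ℝ, (σ = 1 ∨ σ = -1) ∧
      ∃ χ : ℕ → ℕ, StrictMono χ ∧ ∀ n, s (ψ (χ n)) = σ := by
    have hfreq : ∃ᶠ n in atTop, s (ψ n) = 1 ∨ s (ψ n) = -1 :=
      (Eventually.of_forall fun n => hs (ψ n)).frequently
    rcases frequently_or_distrib.1 hfreq with h | h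
    · exact ⟨1, .inl rfl, extraction_of_frequently_atTop h⟩
    · exact ⟨-1, .inr rfl, extraction_of_frequently_atTop h⟩
  have hσσ : σ * σ = 1 := by rcases hσ with rfl | rfl <;> norm_num
  have hnorm (v : cSpace) (hv : ‖v‖ ≤ 1) : ‖σ • T v‖ ≤ 1 := by
    rcases hσ with rfl | rfl <;> simpa using hv
  refine exists_of_coordinate_sequence hφ (x := σ • T onesC) (f := fun k => σ • T (flipC (ψ (χ k))))
    (hnorm _ norm_onesC_le) (fun k => hnorm _ (norm_flipC_le _)) (hmψ.comp hχ)
    (fun n => ?_) (fun n k => ?_)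
  · simp [hone, hsχ, hσσ]
  · simp only [Function.comp_apply, map_smul, smul_eq_mul, hflip, hsχ]
    rcases eq_or_ne k n with rfl | h
    · simp [hσσ]
    · have : ψ (χ k) ≠ ψ (χ n) := (hψ.injective.comp hχ.injective).ne h
      simp [this, h, hσσ]
end
end
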